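/- arXiv:2402.12542 — 6 statements merged into one kernel-verified Lean document; each statement's English description precedes it below -/
import Mathlib

section
/- Let G_1, …, G_n be groups, let G = G_1 × … × G_n act on a set S, and suppose for each 1 ≤ i ≤ n there is a G_i-set S_i, a reduction map π_i : S → S_i, and a normal form function F_i : S_i → S_i for the G_i-action. Then two elements x, y ∈ S lie in the same G-orbit if and only if there exists ω ∈ S that is simultaneously a core element for x and a core element for y. -/
/-- Two elements `x, y : S` lie in the same orbit of the product group
`G 1 × … × G n` if and only if they admit a common core element `ω`. -/
theorem same_orbit_iff_common_core
    {n : ℕ} (G : Fin n → Type*) [∀ i, Group (G i)]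
    (S : Type*) [MulAction ((i : Fin n) → G i) S]
    (Si : Fin n → Type*) [∀ i, MulAction (G i) (Si i)]
    (π : ∀ i, S → Si i)
    (hπ : ∀ (i : Fin n) (g : (i : Fin n) → G i) (x : S), π i (g • x) = g i • π i x)
    (F : ∀ i, Si i → Si i)
    (hF_orbit : ∀ (i : Fin n) (y : Si i), ∃ g : G i, F i y = g • y)
    (hF_const : ∀ (i : Fin n) (y : Si i) (g : G i), F i (g • y) = F i y)
    (x y : S) :
    (∃ g : (i : Fin n) → G i, y = g • x) ↔
      (∃ ω : S,
        ((∃ g : (i : Fin n) → G i, x = g • ω) ∧ ∀ i, π i ω = F i (π i ω)) ∧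
        ((∃ g : (i : Fin n) → G i, y = g • ω) ∧ ∀ i, π i ω = F i (π i ω))) := by
  constructor
  · rintro ⟨g, rfl⟩
    choose h hh using fun i => hF_orbit i (π i x)
    have hcore : ∀ i, π i (h • x) = F i (π i (h • x)) := fun i => by
      rw [hπ, hF_const, hh]
    exact ⟨h • x, ⟨⟨h⁻¹, (inv_smul_smul h x).symm⟩, hcore⟩,
      ⟨g * h⁻¹, by rw [mul_smul, inv_smul_smul]⟩, hcore⟩
  · rintro ⟨ω, ⟨⟨a, rfl⟩, -⟩, ⟨b, rfl⟩, -⟩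
    exact ⟨b * a⁻¹, by rw [mul_smul, inv_smul_smul]⟩
end

section
/- (HOSVD) Let d_1, …, d_n be positive integers and let Φ ∈ ℂ^{d_1} ⊗ … ⊗ ℂ^{d_n} be a tensor, identified with a function ∏ᵢ Fin dᵢ → ℂ. Then there exist unitary matrices Uᵢ ∈ U(dᵢ) for 1 ≤ i ≤ n and a tensor Ω ∈ ℂ^{d_1} ⊗ … ⊗ ℂ^{d_n} such that Φ = (U_1 ⊗ … ⊗ U_n)Ω and, for every 1 ≤ i ≤ n, the dᵢ × dᵢ matrix Ω₍ᵢ₎Ω₍ᵢ₎* is diagonal with real, nonnegative, weakly decreasing diagonal entries. -/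
open Matrix

noncomputable section

/-- The mode-`i` flattening of a tensor `Φ ∈ ℂ^{d 1} ⊗ ⋯ ⊗ ℂ^{d n}`, viewed as a
`d i × ∏_{j ≠ i} d j` matrix. -/
def mflat {n : ℕ} {d : Fin n → ℕ} (Φ : (∀ i, Fin (d i)) → ℂ) (i : Fin n) :
    Matrix (Fin (d i)) ((j : {j : Fin n // j ≠ i}) → Fin (d j.1)) ℂ :=
  Matrix.of fun a w => Φ (fun j => if h : j = i then (Fin.cast (by rw [h]) a) else w ⟨j, h⟩)

/-- The action of the Kronecker product `g 1 ⊗ ⋯ ⊗ g n` of square matrices on a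
tensor `Φ ∈ ℂ^{d 1} ⊗ ⋯ ⊗ ℂ^{d n}`. -/
def mact {n : ℕ} {d : Fin n → ℕ} (g : ∀ i, Matrix (Fin (d i)) (Fin (d i)) ℂ)
    (Φ : (∀ i, Fin (d i)) → ℂ) : (∀ i, Fin (d i)) → ℂ :=
  fun v => ∑ w : ∀ i, Fin (d i), (∏ i, g i (v i) (w i)) * Φ w

/-- The Kronecker product of a finite family of square matrices, indexed by dependent functions. -/
def piKronecker {ι : Type*} [Fintype ι] {m : ι → Type*} (g : ∀ i, Matrix (m i) (m i) ℂ) :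
    Matrix (∀ i, m i) (∀ i, m i) ℂ :=
  Matrix.of fun v w => ∏ i, g i (v i) (w i)

theorem piKronecker_mul {ι : Type*} [Fintype ι] [DecidableEq ι] {m : ι → Type*}
    [∀ i, Fintype (m i)] (g h : ∀ i, Matrix (m i) (m i) ℂ) :
    piKronecker g * piKronecker h = piKronecker fun i => g i * h i := by
  ext v w
  simp only [piKronecker, Matrix.mul_apply, Matrix.of_apply, ← Finset.prod_mul_distrib]
  rw [Finset.prod_univ_sum, Fintype.piFinset_univ]

theorem piKronecker_one {ι : Type*} [Fintype ι] {m : ι → Type*}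
    [∀ i, DecidableEq (m i)] :
    piKronecker (fun i => (1 : Matrix (m i) (m i) ℂ)) = 1 := by
  ext v w
  by_cases hvw : v = w
  · subst hvw
    rw [Matrix.one_apply_eq]
    exact Finset.prod_eq_one fun i _ => Matrix.one_apply_eq (v i)
  · obtain ⟨i, hi⟩ := Function.ne_iff.mp hvw
    rw [Matrix.one_apply_ne hvw]
    exact Finset.prod_eq_zero (Finset.mem_univ i) (Matrix.one_apply_ne hi)

theorem piKronecker_conjTranspose {ι : Type*} [Fintype ι] {m : ι → Type*}
    (g : ∀ i, Matrix (m i) (m i) ℂ) :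
    (piKronecker g)ᴴ = piKronecker fun i => (g i)ᴴ := by
  ext v w
  simp [piKronecker, Matrix.conjTranspose_apply]

theorem mact_eq_mulVec {n : ℕ} {d : Fin n → ℕ} (g : ∀ i, Matrix (Fin (d i)) (Fin (d i)) ℂ)
    (Φ : (∀ i, Fin (d i)) → ℂ) : mact g Φ = piKronecker g *ᵥ Φ :=
  rfl

theorem mact_mact {n : ℕ} {d : Fin n → ℕ} (g h : ∀ i, Matrix (Fin (d i)) (Fin (d i)) ℂ)
    (Φ : (∀ i, Fin (d i)) → ℂ) : mact g (mact h Φ) = mact (fun i => g i * h i) Φ := by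
  simp only [mact_eq_mulVec, Matrix.mulVec_mulVec, piKronecker_mul]

theorem mact_one {n : ℕ} {d : Fin n → ℕ} (Φ : (∀ i, Fin (d i)) → ℂ) :
    mact (fun _ => 1) Φ = Φ := by
  rw [mact_eq_mulVec, piKronecker_one, Matrix.one_mulVec]

theorem mflat_apply {n : ℕ} {d : Fin n → ℕ} (Φ : (∀ i, Fin (d i)) → ℂ) (i : Fin n)
    (a : Fin (d i)) (w : (j : {j : Fin n // j ≠ i}) → Fin (d j.1)) :
    mflat Φ i a w = Φ ((Equiv.piSplitAt i fun j => Fin (d j)).symm (a, w)) := by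
  simp only [mflat, Matrix.of_apply]
  congr 1
  funext j
  by_cases h : j = i
  · subst h
    simp [Equiv.piSplitAt]
  · simp [Equiv.piSplitAt, h]

/-- The action of a Kronecker product on a tensor, read off on the mode-`i` flattening. -/
theorem mflat_mact {n : ℕ} {d : Fin n → ℕ} (g : ∀ i, Matrix (Fin (d i)) (Fin (d i)) ℂ)
    (Φ : (∀ i, Fin (d i)) → ℂ) (i : Fin n) :
    mflat (mact g Φ) i =
      g i * mflat Φ i * (piKronecker fun j : {j : Fin n // j ≠ i} => g j.1)ᵀ := by
  ext a w
  have key (b : Fin (d i)) (u : (j : {j : Fin n // j ≠ i}) → Fin (d j.1)) :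
      ∏ j, g j ((Equiv.piSplitAt i fun j => Fin (d j)).symm (a, w) j)
        ((Equiv.piSplitAt i fun j => Fin (d j)).symm (b, u) j) =
      g i a b * ∏ j : {j : Fin n // j ≠ i}, g j.1 (w j) (u j) := by
    rw [Fintype.prod_eq_mul_prod_subtype_ne _ i]
    congr 1
    · simp [Equiv.piSplitAt]
    · refine Finset.prod_congr rfl fun j _ => ?_
      simp [Equiv.piSplitAt, j.2]
  rw [mflat_apply, mact, ← (Equiv.piSplitAt i fun j => Fin (d j)).symm.sum_comp,
    Fintype.sum_prod_type_right]
  simp only [key, Matrix.mul_apply, Matrix.transpose_apply, mflat_apply, Finset.sum_mul,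
    piKronecker, Matrix.of_apply]
  exact Finset.sum_congr rfl fun u _ => Finset.sum_congr rfl fun b _ => by ring

/-- Under a unitary change of basis in every mode, the mode-`i` Gram matrix is conjugated by the
`i`-th unitary. -/
theorem mflat_mact_mul_conjTranspose {n : ℕ} {d : Fin n → ℕ}
    (g : ∀ i, Matrix (Fin (d i)) (Fin (d i)) ℂ) (hg : ∀ i, (g i)ᴴ * g i = 1)
    (Φ : (∀ i, Fin (d i)) → ℂ) (i : Fin n) :
    mflat (mact g Φ) i * (mflat (mact g Φ) i)ᴴ =
      g i * (mflat Φ i * (mflat Φ i)ᴴ) * (g i)ᴴ := by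
  set K := piKronecker fun j : {j : Fin n // j ≠ i} => g j.1 with hK
  have hKK : Kᵀ * Kᵀᴴ = 1 := by
    have h : Kᴴ * K = 1 := by
      rw [hK, piKronecker_conjTranspose, piKronecker_mul]
      simp only [hg, piKronecker_one]
    rw [show Kᵀᴴ = Kᴴᵀ from rfl, ← Matrix.transpose_mul, h, Matrix.transpose_one]
  rw [mflat_mact, ← hK, Matrix.conjTranspose_mul, Matrix.conjTranspose_mul]
  calc g i * mflat Φ i * Kᵀ * (Kᵀᴴ * ((mflat Φ i)ᴴ * (g i)ᴴ))
      = g i * mflat Φ i * (Kᵀ * Kᵀᴴ) * ((mflat Φ i)ᴴ * (g i)ᴴ) := by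
        simp only [Matrix.mul_assoc]
    _ = g i * (mflat Φ i * (mflat Φ i)ᴴ) * (g i)ᴴ := by
        rw [hKK, Matrix.mul_one]
        simp only [Matrix.mul_assoc]

/-- A Hermitian matrix is unitarily diagonalizable with weakly decreasing eigenvalues. -/
theorem Matrix.IsHermitian.exists_antitone_diagonalization {m : ℕ}
    {A : Matrix (Fin m) (Fin m) ℂ} (hA : A.IsHermitian) :
    ∃ (V : Matrix (Fin m) (Fin m) ℂ) (e : Fin m → ℝ), Vᴴ * V = 1 ∧ Antitone e ∧
      Vᴴ * A * V = Matrix.diagonal fun p => (e p : ℂ) := by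
  let σ := Tuple.sort fun p => -hA.eigenvalues p
  let W : Matrix (Fin m) (Fin m) ℂ := hA.eigenvectorUnitary
  have hWW : Wᴴ * W = 1 := Unitary.coe_star_mul_self hA.eigenvectorUnitary
  have hWA : Wᴴ * A * W = Matrix.diagonal fun p => (hA.eigenvalues p : ℂ) := by
    have h := hA.conjStarAlgAut_star_eigenvectorUnitary
    rw [Unitary.conjStarAlgAut_star_apply] at h
    exact h
  have hsub : (W.submatrix id σ)ᴴ = Wᴴ.submatrix σ id := Matrix.conjTranspose_submatrix _ _ _
  refine ⟨W.submatrix id σ, hA.eigenvalues ∘ σ, ?_, ?_, ?_⟩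
  · rw [hsub, ← Matrix.submatrix_mul _ _ _ _ _ Function.bijective_id, hWW,
      Matrix.submatrix_one_equiv]
  · intro p q hpq
    exact neg_le_neg_iff.mp (Tuple.monotone_sort (fun p => -hA.eigenvalues p) hpq)
  · change (W.submatrix id σ)ᴴ * A.submatrix id id * W.submatrix id σ = _
    rw [hsub, ← Matrix.submatrix_mul _ _ _ _ _ Function.bijective_id,
      ← Matrix.submatrix_mul _ _ _ _ _ Function.bijective_id, hWA,
      Matrix.submatrix_diagonal_equiv]
    rfl

/-- **HOSVD** (De Lathauwer–De Moor–Vandewalle). Every tensor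
`Φ ∈ ℂ^{d 1} ⊗ ⋯ ⊗ ℂ^{d n}` can be written as `Φ = (U 1 ⊗ ⋯ ⊗ U n) Ω` with each
`U i` unitary and each Gram matrix `Ω₍ᵢ₎ Ω₍ᵢ₎*` of the flattenings of the core
tensor `Ω` diagonal with real, nonnegative, weakly decreasing diagonal entries. -/
theorem hosvd {n : ℕ} {d : Fin n → ℕ} (hd : ∀ i, 0 < d i)
    (Φ : (∀ i, Fin (d i)) → ℂ) :
    ∃ (U : ∀ i, Matrix (Fin (d i)) (Fin (d i)) ℂ) (Ω : (∀ i, Fin (d i)) → ℂ),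
      (∀ i, (U i)ᴴ * U i = 1) ∧
      Φ = mact U Ω ∧
      (∀ i, (mflat Ω i * (mflat Ω i)ᴴ).IsDiag) ∧
      (∀ (i : Fin n) (p : Fin (d i)),
        ((mflat Ω i * (mflat Ω i)ᴴ) p p).im = 0 ∧
        0 ≤ ((mflat Ω i * (mflat Ω i)ᴴ) p p).re) ∧
      (∀ (i : Fin n) (p q : Fin (d i)), p ≤ q →
        ((mflat Ω i * (mflat Ω i)ᴴ) q q).re ≤ ((mflat Ω i * (mflat Ω i)ᴴ) p p).re) := by
  choose V e hV he hVA using fun i =>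
    (Matrix.isHermitian_mul_conjTranspose_self (mflat Φ i)).exists_antitone_diagonalization
  have hV' (i : Fin n) : V i * (V i)ᴴ = 1 := mul_eq_one_comm.mp (hV i)
  have hgram (i : Fin n) :
      mflat (mact (fun i => (V i)ᴴ) Φ) i * (mflat (mact (fun i => (V i)ᴴ) Φ) i)ᴴ =
        Matrix.diagonal fun p => (e i p : ℂ) := by
    rw [mflat_mact_mul_conjTranspose _ (fun i => by rw [Matrix.conjTranspose_conjTranspose, hV' i]),
      Matrix.conjTranspose_conjTranspose, hVA]
  refine ⟨V, mact (fun i => (V i)ᴴ) Φ, hV, ?_, fun i => ?_, fun i p => ?_, fun i p q hpq => ?_⟩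
  · simp only [mact_mact, hV', mact_one]
  · rw [hgram]
    exact Matrix.isDiag_diagonal _
  · open scoped ComplexOrder in
    have h := (Matrix.posSemidef_self_mul_conjTranspose
      (mflat (mact (fun i => (V i)ᴴ) Φ) i)).diag_nonneg (i := p)
    exact ⟨(Complex.nonneg_iff.mp h).2.symm, (Complex.nonneg_iff.mp h).1⟩
  · simpa [hgram] using he i hpq

end
end

section
/- (Orthogonal spectral theorem for generic symmetric matrices) Let A ∈ ℂ^{d×d} be a complex symmetric matrix (A = Aᵀ) with d distinct eigenvalues. Then there exist U ∈ SO_d(ℂ) and a diagonal matrix D ∈ ℂ^{d×d} such that A = U D Uᵀ. -/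
open Matrix Polynomial

/-- A square matrix over a field whose characteristic polynomial has distinct roots `mu i` is
diagonalizable, with eigenvalues `mu i`. -/
theorem exists_isUnit_mul_diagonal_of_charpoly_eq_prod {n K : Type*} [Fintype n] [DecidableEq n]
    [Field K] (A : Matrix n n K) (mu : n → K) (hmu : Function.Injective mu)
    (hchar : A.charpoly = ∏ i, (X - C (mu i))) :
    ∃ P : Matrix n n K, IsUnit P ∧ A * P = P * diagonal mu := by
  have hev : ∀ i, ∃ v : n → K, v ≠ 0 ∧ A *ᵥ v = mu i • v := by
    intro i
    have hdet : (scalar n (mu i) - A).det = 0 := by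
      rw [← eval_charpoly, hchar, eval_prod]
      exact Finset.prod_eq_zero (Finset.mem_univ i) (by simp)
    obtain ⟨v, hv, h⟩ := exists_mulVec_eq_zero_iff.mpr hdet
    refine ⟨v, hv, ?_⟩
    rw [sub_mulVec, sub_eq_zero] at h
    rw [← h, scalar_apply, ← smul_one_eq_diagonal, smul_mulVec, one_mulVec]
  choose v hv hAv using hev
  have hli : LinearIndependent K v :=
    Module.End.eigenvectors_linearIndependent' (toLin' A) mu hmu v fun i =>
      ⟨Module.End.mem_eigenspace_iff.mpr (by simpa using hAv i), hv i⟩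
  refine ⟨(of v)ᵀ, linearIndependent_cols_iff_isUnit.mp hli, ?_⟩
  ext i j
  rw [mul_diagonal, mul_comm]
  exact congrFun (hAv j) i

/-- The Gram matrix of eigenvectors of a symmetric matrix for distinct eigenvalues is diagonal. -/
theorem isDiag_transpose_mul_self_of_mul_eq_mul_diagonal {n K : Type*} [Fintype n] [DecidableEq n]
    [Field K] {A P : Matrix n n K} {mu : n → K} (hA : Aᵀ = A) (hmu : Function.Injective mu)
    (hP : A * P = P * diagonal mu) : (Pᵀ * P).IsDiag := by
  have hcomm : diagonal mu * (Pᵀ * P) = Pᵀ * P * diagonal mu := by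
    have ht : Pᵀ * A = diagonal mu * Pᵀ := by
      simpa [transpose_mul, hA] using congrArg transpose hP
    rw [← Matrix.mul_assoc, ← ht, Matrix.mul_assoc, hP, Matrix.mul_assoc]
  intro i j hij
  have h := congrFun (congrFun hcomm i) j
  rw [diagonal_mul, mul_diagonal, mul_comm] at h
  by_contra h0
  exact hij (hmu (mul_left_cancel₀ h0 h))

/-- An invertible matrix over an algebraically closed field whose columns are pairwise orthogonal
can be made special orthogonal by rescaling its columns. -/
theorem exists_diagonal_mul_specialOrthogonal {n K : Type*} [Fintype n] [DecidableEq n]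
    [Field K] [IsAlgClosed K] {P : Matrix n n K} (hP : IsUnit P) (hdiag : (Pᵀ * P).IsDiag) :
    ∃ c : n → K, (P * diagonal c)ᵀ * (P * diagonal c) = 1 ∧ (P * diagonal c).det = 1 := by
  obtain ⟨g, hg⟩ : ∃ g, Pᵀ * P = diagonal g := ⟨_, hdiag.diagonal_diag.symm⟩
  have hg0 : ∀ i, g i ≠ 0 := by
    have h : (diagonal g).det ≠ 0 := by
      rw [← hg, det_mul, det_transpose]
      have := ((isUnit_iff_isUnit_det P).mp hP).ne_zero
      exact mul_ne_zero this this
    rw [det_diagonal] at h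
    exact fun i => Finset.prod_ne_zero_iff.mp h i (Finset.mem_univ i)
  have horth : ∀ c : n → K, (∀ i, c i * c i * g i = 1) →
      (P * diagonal c)ᵀ * (P * diagonal c) = 1 := by
    intro c hc
    rw [transpose_mul, diagonal_transpose, Matrix.mul_assoc, ← Matrix.mul_assoc Pᵀ, hg,
      diagonal_mul_diagonal, diagonal_mul_diagonal, ← diagonal_one]
    congr 1
    ext i
    rw [← hc i]
    ring
  choose c hc using fun i => IsAlgClosed.exists_eq_mul_self (g i)⁻¹
  have hcg : ∀ i, c i * c i * g i = 1 := fun i => by rw [← hc, inv_mul_cancel₀ (hg0 i)]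
  have hsq : (P * diagonal c).det * (P * diagonal c).det = 1 := by
    simpa only [det_mul, det_transpose, det_one] using congrArg det (horth c hcg)
  rcases mul_self_eq_one_iff.mp hsq with h | h
  · exact ⟨c, horth c hcg, h⟩
  rcases isEmpty_or_nonempty n with hn | ⟨⟨k⟩⟩
  · exact ⟨c, horth c hcg, det_isEmpty⟩
  refine ⟨Function.update c k (-c k), horth _ fun i => ?_, ?_⟩
  · rcases eq_or_ne i k with rfl | hik
    · simpa using hcg i
    · simpa [hik] using hcg i
  · rw [det_mul, det_diagonal, Finset.prod_update_of_mem (Finset.mem_univ k), neg_mul, mul_neg,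
      neg_eq_iff_eq_neg, ← h, det_mul, det_diagonal,
      ← Finset.mul_prod_erase _ c (Finset.mem_univ k), Finset.sdiff_singleton_eq_erase]

/-- **Orthogonal spectral theorem for generic complex symmetric matrices.**
If `A` is a `d × d` complex symmetric matrix whose characteristic polynomial has
`d` pairwise distinct roots, then `A = U * D * Uᵀ` for some `U ∈ SO_d(ℂ)` and
some diagonal matrix `D`. -/
theorem symmetric_matrix_orthogonal_diagonalization
    {d : ℕ} (A : Matrix (Fin d) (Fin d) ℂ) (hA : Aᵀ = A)
    (mu : Fin d → ℂ) (hmu : Function.Injective mu)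
    (hchar : A.charpoly = ∏ i, (X - C (mu i))) :
    ∃ (U D : Matrix (Fin d) (Fin d) ℂ),
      Uᵀ * U = 1 ∧ U.det = 1 ∧ D.IsDiag ∧ A = U * D * Uᵀ := by
  obtain ⟨P, hPu, hP⟩ := exists_isUnit_mul_diagonal_of_charpoly_eq_prod A mu hmu hchar
  obtain ⟨c, horth, hdet⟩ := exists_diagonal_mul_specialOrthogonal hPu
    (isDiag_transpose_mul_self_of_mul_eq_mul_diagonal hA hmu hP)
  refine ⟨P * diagonal c, diagonal mu, horth, hdet, isDiag_diagonal mu, ?_⟩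
  have hAU : A * (P * diagonal c) = P * diagonal c * diagonal mu := by
    rw [← Matrix.mul_assoc, hP, Matrix.mul_assoc, Matrix.mul_assoc,
      (commute_diagonal mu c).eq]
  rw [← hAU, Matrix.mul_assoc, mul_eq_one_comm.mp horth, Matrix.mul_one]
end

section
/- Let λ ∈ ℂ and k ≥ 1, and let S_k(λ) be the k × k symmetrized Jordan block. Then the stabilizer of S_k(λ) in the complex orthogonal group O_k(ℂ) under conjugation is {I_k, −I_k}; that is, U ∈ O_k(ℂ) satisfies U S_k(λ) U^{−1} = S_k(λ) if and only if U = ±I_k. -/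
open Matrix

noncomputable section

/-- The `k × k` symmetrized Jordan block `S_k(λ)`. -/
def symJordan (k : ℕ) (lam : ℂ) : Matrix (Fin k) (Fin k) ℂ :=
  Matrix.of fun p q =>
    (if p = q then lam else if p.1 + 1 = q.1 ∨ q.1 + 1 = p.1 then 1 else 0)
    + Complex.I * (if p.1 + q.1 + 2 = k then 1 else if p.1 + q.1 = k then -1 else 0)

/-- An involution that is a polynomial in a nilpotent element is `1` or `-1`. -/
lemma eq_one_or_eq_neg_one_of_aeval_nilpotent {R : Type*} [Ring R] [Nontrivial R] [Algebra ℂ R]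
    {N : R} (hN : IsNilpotent N) (p : Polynomial ℂ)
    (h : Polynomial.aeval N p * Polynomial.aeval N p = 1) :
    Polynomial.aeval N p = 1 ∨ Polynomial.aeval N p = -1 := by
  obtain ⟨M, hM, hp⟩ : ∃ M : R, IsNilpotent M ∧
      Polynomial.aeval N p = M + algebraMap ℂ R (p.coeff 0) := by
    refine ⟨Polynomial.aeval N p.divX * N, ?_, ?_⟩
    · refine Commute.isNilpotent_mul_left ?_ hN
      simpa using (Commute.all p.divX Polynomial.X).map (Polynomial.aeval N)
    · conv_lhs => rw [← Polynomial.divX_mul_X_add p]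
      simp
  set a := p.coeff 0
  have key : M * (M + algebraMap ℂ R (2 * a)) = algebraMap ℂ R (1 - a ^ 2) := by
    rw [hp] at h
    have hc := Algebra.commutes a M
    simp only [map_sub, map_one, map_mul, map_pow, map_ofNat, ← h]
    simp only [mul_add, add_mul, two_mul, hc, pow_two]
    abel
  have ha : 1 - a ^ 2 = 0 := by
    have hnil : IsNilpotent (algebraMap ℂ R (1 - a ^ 2)) := by
      rw [← key]
      exact Commute.isNilpotent_mul_right
        ((Commute.refl M).add_right (Algebra.commutes _ M).symm) hM
    exact ((IsNilpotent.map_iff (algebraMap ℂ R).injective).1 hnil).eq_zero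
  have hunit : IsUnit (M + algebraMap ℂ R (2 * a)) := by
    refine hM.isUnit_add_right_of_commute ?_ (Algebra.commutes _ M).symm
    refine IsUnit.map _ (IsUnit.mk0 _ ?_)
    rintro h0
    have : a = 0 := by simpa using h0
    simp [this] at ha
  have hM0 : M = 0 := by
    rw [ha, map_zero] at key
    exact hunit.mul_left_eq_zero.1 key
  have : (a - 1) * (a + 1) = 0 := by linear_combination -ha
  rcases mul_eq_zero.1 this with h1 | h1
  · left; rw [hp, hM0, sub_eq_zero.1 h1]; simp
  · right; rw [hp, hM0, eq_neg_of_add_eq_zero_left h1]; simp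

/-- The nilpotent upper shift matrix. -/
def upperShift (k : ℕ) : Matrix (Fin k) (Fin k) ℂ :=
  Matrix.of fun p q => if p.1 + 1 = q.1 then 1 else 0

/-- The exchange matrix, with ones on the antidiagonal. -/
def exchange (k : ℕ) : Matrix (Fin k) (Fin k) ℂ :=
  (1 : Matrix (Fin k) (Fin k) ℂ).submatrix Fin.rev id

lemma exchange_mul {k : ℕ} (A : Matrix (Fin k) (Fin k) ℂ) :
    exchange k * A = A.submatrix Fin.rev id := by
  ext p q
  simp [exchange, Matrix.mul_apply, Matrix.one_apply]

lemma mul_exchange {k : ℕ} (A : Matrix (Fin k) (Fin k) ℂ) :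
    A * exchange k = A.submatrix id Fin.rev := by
  ext p q
  simp [exchange, Matrix.mul_apply, Matrix.one_apply, Fin.rev_eq_iff]

lemma exchange_mul_self (k : ℕ) : exchange k * exchange k = 1 := by
  rw [exchange_mul]
  ext p q
  rw [exchange, Matrix.submatrix_apply, Matrix.submatrix_apply, Fin.rev_rev, id, id]

lemma upperShift_pow_apply {k : ℕ} (m : ℕ) (p q : Fin k) :
    (upperShift k ^ m) p q = if p.1 + m = q.1 then 1 else 0 := by
  induction m generalizing p q with
  | zero => simp [Matrix.one_apply, Fin.ext_iff]
  | succ m ih =>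
    rw [pow_succ, Matrix.mul_apply]
    simp only [ih]
    simp only [upperShift, Matrix.of_apply, mul_ite, mul_one, mul_zero]
    by_cases h : p.1 + (m + 1) = q.1
    · rw [Finset.sum_eq_single ⟨p.1 + m, by omega⟩]
      · rw [if_pos rfl, if_pos (by simp only; omega), if_pos h]
      · intro b _ hb
        have : p.1 + m ≠ b.1 := fun h' => hb (Fin.ext h'.symm)
        simp [this]
      · simp
    · rw [if_neg h]
      refine Finset.sum_eq_zero fun b _ => ?_
      split_ifs <;> first | rfl | omega

lemma isNilpotent_upperShift (k : ℕ) : IsNilpotent (upperShift k) := by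
  refine ⟨k, ?_⟩
  ext p q
  rw [upperShift_pow_apply, if_neg (by omega), Matrix.zero_apply]

/-- A matrix commuting with the upper shift is a polynomial in it. -/
lemma exists_aeval_upperShift_of_commute {k : ℕ} (hk : 0 < k) {V : Matrix (Fin k) (Fin k) ℂ}
    (hV : Commute V (upperShift k)) : ∃ p : Polynomial ℂ, V = Polynomial.aeval (upperShift k) p := by
  obtain ⟨n, rfl⟩ : ∃ n, k = n + 1 := ⟨k - 1, by omega⟩
  refine ⟨∑ l : Fin (n + 1), Polynomial.C (V l (Fin.last n)) * Polynomial.X ^ (n - l.1), ?_⟩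
  ext i j
  have h := congrFun (congrFun (hV.pow_right (n - j.1)).eq i) (Fin.last n)
  have hl : (V * upperShift (n + 1) ^ (n - j.1)) i (Fin.last n) = V i j := by
    rw [Matrix.mul_apply, Finset.sum_eq_single j]
    · rw [upperShift_pow_apply, if_pos (by simp; omega), mul_one]
    · intro b _ hb
      have : b.1 ≠ j.1 := fun h' => hb (Fin.ext h')
      rw [upperShift_pow_apply, if_neg (by simp; omega), mul_zero]
    · simp
  rw [← hl, h, Matrix.mul_apply]
  simp only [map_sum, map_mul, Polynomial.aeval_C, map_pow, Polynomial.aeval_X, Matrix.sum_apply,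
    ← Algebra.smul_def, Matrix.smul_apply, upperShift_pow_apply, smul_eq_mul]
  refine Finset.sum_congr rfl fun l _ => ?_
  rw [mul_comm]
  congr 1
  exact if_congr (by omega) rfl rfl

/-- Conjugation commutes with polynomial evaluation. -/
lemma aeval_conj_of_mul_eq_one {R : Type*} [Ring R] [Algebra ℂ R] {P Q : R} (hPQ : P * Q = 1)
    (hQP : Q * P = 1) (A : R) (p : Polynomial ℂ) :
    Polynomial.aeval (P * A * Q) p = P * Polynomial.aeval A p * Q := by
  have hpow := fun n => Units.conj_pow ⟨P, Q, hPQ, hQP⟩ A n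
  simp only [Units.val_mk, Units.inv_mk] at hpow
  simp only [Polynomial.aeval_eq_sum_range, Finset.mul_sum, Finset.sum_mul, hpow,
    mul_smul_comm, smul_mul_assoc]

lemma symJordan_eq (k : ℕ) (lam : ℂ) :
    symJordan k lam = lam • 1 + (1 - Complex.I • exchange k) * upperShift k *
      (1 + Complex.I • exchange k) := by
  have h : (1 - Complex.I • exchange k) * upperShift k * (1 + Complex.I • exchange k) =
      upperShift k + (upperShift k).submatrix Fin.rev Fin.rev +
      Complex.I • ((upperShift k).submatrix id Fin.rev - (upperShift k).submatrix Fin.rev id) := by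
    simp only [mul_add, sub_mul, one_mul, mul_one, smul_mul_assoc, mul_smul_comm, smul_sub,
      smul_smul, Complex.I_mul_I, exchange_mul, mul_exchange, neg_smul, one_smul,
      Matrix.submatrix_submatrix, Function.comp_id, Function.id_comp]
    abel
  rw [h]
  ext p q
  have hp := p.2
  have hq := q.2
  have e1 : (p.rev.1 + 1 = q.rev.1) ↔ q.1 + 1 = p.1 := by simp only [Fin.val_rev]; omega
  have e2 : (p.1 + 1 = q.rev.1) ↔ p.1 + q.1 + 2 = k := by simp only [Fin.val_rev]; omega
  have e3 : (p.rev.1 + 1 = q.1) ↔ p.1 + q.1 = k := by simp only [Fin.val_rev]; omega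
  simp only [symJordan, upperShift, Matrix.of_apply, Matrix.add_apply, Matrix.smul_apply,
    Matrix.sub_apply, Matrix.submatrix_apply, id, e1, e2, e3, Matrix.one_apply, Fin.ext_iff,
    smul_eq_mul]
  split_ifs <;> first | omega | simp

lemma transpose_symJordan (k : ℕ) (lam : ℂ) : (symJordan k lam)ᵀ = symJordan k lam := by
  ext p q
  simp only [symJordan, Matrix.transpose_apply, Matrix.of_apply, eq_comm (a := q), add_comm q.1 p.1,
    or_comm (a := q.1 + 1 = p.1)]

/-- Every matrix commuting with `S_k(λ)` is symmetric and is a polynomial in a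
nilpotent matrix. -/
lemma symmetric_and_exists_aeval_nilpotent_of_commute_symJordan {k : ℕ} (hk : 0 < k) {lam : ℂ}
    {U : Matrix (Fin k) (Fin k) ℂ} (hU : Commute U (symJordan k lam)) :
    Uᵀ = U ∧ ∃ N, IsNilpotent N ∧ ∃ p : Polynomial ℂ, U = Polynomial.aeval N p := by
  set P := 1 - Complex.I • exchange k with hP
  set Q := (2⁻¹ : ℂ) • (1 + Complex.I • exchange k) with hQ
  have hPQ : P * Q = 1 := by
    simp only [hP, hQ, mul_add, sub_mul, one_mul, mul_one, smul_mul_assoc, mul_smul_comm, smul_sub,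
      smul_smul, Complex.I_mul_I, exchange_mul_self]
    module
  have hQP : Q * P = 1 := mul_eq_one_comm.1 hPQ
  set N := P * upperShift k * Q with hN
  have hNS : N = (2⁻¹ : ℂ) • (symJordan k lam - lam • 1) := by
    rw [symJordan_eq, add_sub_cancel_left, hN, hQ, mul_smul_comm]
  have hNT : Nᵀ = N := by
    rw [hNS]
    simp [transpose_symJordan]
  have hUN : Commute U N := by
    rw [hNS]
    exact (hU.sub_right ((Commute.one_right U).smul_right lam)).smul_right _
  have hJ : upperShift k = Q * N * P := by
    rw [hN]
    simp only [← mul_assoc, hQP, one_mul]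
    rw [mul_assoc, hQP, mul_one]
  have hV : Commute (Q * U * P) (upperShift k) := by
    have conj : ∀ A B, Q * A * P * (Q * B * P) = Q * (A * B) * P := fun A B => by
      calc _ = Q * A * (P * Q) * B * P := by simp only [mul_assoc]
        _ = _ := by rw [hPQ]; simp only [mul_assoc, one_mul]
    rw [hJ, commute_iff_eq, conj, conj, hUN.eq]
  obtain ⟨p, hp⟩ := exists_aeval_upperShift_of_commute hk hV
  have hUp : U = Polynomial.aeval N p := by
    rw [hN, aeval_conj_of_mul_eq_one hPQ hQP, ← hp]
    simp only [← mul_assoc, hPQ, one_mul]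
    rw [mul_assoc, hPQ, mul_one]
  refine ⟨?_, N, ?_, p, hUp⟩
  · rw [hUp]
    simp only [Polynomial.aeval_eq_sum_range, Matrix.transpose_sum, Matrix.transpose_smul,
      Matrix.transpose_pow, hNT]
  · obtain ⟨m, hm⟩ := isNilpotent_upperShift k
    refine ⟨m, ?_⟩
    have := aeval_conj_of_mul_eq_one hPQ hQP (upperShift k) (Polynomial.X ^ m)
    simpa [hm] using this

/-- The stabilizer of the symmetrized Jordan block `S_k(λ)` in the complex
orthogonal group `O_k(ℂ)` under conjugation is `{I, −I}`. -/
theorem orthogonal_stabilizer_of_symmetrized_jordan_block {k : ℕ} (hk : 0 < k) (lam : ℂ)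
    (U : Matrix (Fin k) (Fin k) ℂ) (hU : Uᵀ * U = 1) :
    U * symJordan k lam * U⁻¹ = symJordan k lam ↔ (U = 1 ∨ U = -1) := by
  have : Nonempty (Fin k) := ⟨⟨0, hk⟩⟩
  have hinv : U⁻¹ = Uᵀ := Matrix.inv_eq_left_inv hU
  rw [hinv]
  constructor
  · intro h
    have hcomm : Commute U (symJordan k lam) := by
      rw [commute_iff_eq]
      have h' := congrArg (· * U) h
      simpa only [mul_assoc, hU, mul_one] using h'
    obtain ⟨hsymm, N, hN, p, rfl⟩ :=
      symmetric_and_exists_aeval_nilpotent_of_commute_symJordan hk hcomm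
    rw [hsymm] at hU
    exact eq_one_or_eq_neg_one_of_aeval_nilpotent hN p hU
  · rintro (rfl | rfl) <;> simp

end
end

section
/- Let n be odd and let Φ ∈ (ℂ²)^{⊗n}. Then there exist A_1, …, A_n ∈ SL_2(ℂ) and a tensor Ψ ∈ (ℂ²)^{⊗n} such that Φ = (A_1 ⊗ … ⊗ A_n)Ψ and, for every 1 ≤ i ≤ n, the 2 × 2 complex symmetric matrix D_i = Ψ₍ᵢ₎ · J^{⊗(n−1)} · Ψ₍ᵢ₎ᵀ is equal to z_i·I_2, or to diag(z_i, 0), or to the zero matrix, for some z_i ∈ ℂ with z_i ≥ −z_i in the lexicographic order on ℂ. -/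
open Matrix

noncomputable section

/-- The standard symplectic `2 × 2` matrix `J`. -/
def J : Matrix (Fin 2) (Fin 2) ℂ := !![0, 1; -1, 0]

/-- The Kronecker power `J^{⊗ι}` of `J`, indexed by an arbitrary finite index type. -/
def kronPowJ (ι : Type) [Fintype ι] : Matrix (ι → Fin 2) (ι → Fin 2) ℂ :=
  Matrix.of fun v w => ∏ j, J (v j) (w j)

/-- The mode-`i` flattening of an `n`-qubit tensor, as a `2 × 2^{n-1}` matrix. -/
def qflat {n : ℕ} (Φ : (Fin n → Fin 2) → ℂ) (i : Fin n) :
    Matrix (Fin 2) ({j : Fin n // j ≠ i} → Fin 2) ℂ :=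
  Matrix.of fun a w => Φ (fun j => if h : j = i then a else w ⟨j, h⟩)

/-- The action of the Kronecker product `A 1 ⊗ ⋯ ⊗ A n` of `2 × 2` matrices on an
`n`-qubit tensor. -/
def act2 {n : ℕ} (A : Fin n → Matrix (Fin 2) (Fin 2) ℂ)
    (Φ : (Fin n → Fin 2) → ℂ) : (Fin n → Fin 2) → ℂ :=
  fun v => ∑ w : Fin n → Fin 2, (∏ i, A i (v i) (w i)) * Φ w

/-- The (weak) lexicographic order on `ℂ`: real parts first, then imaginary parts. -/
def clexLe (z w : ℂ) : Prop := z.re < w.re ∨ (z.re = w.re ∧ z.im ≤ w.im)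

/-- The strict lexicographic order on `ℂ`. -/
def clexLt (z w : ℂ) : Prop := z.re < w.re ∨ (z.re = w.re ∧ z.im < w.im)

end

noncomputable section

/-- The Kronecker product of a finite family of `2 × 2` matrices. -/
def kronFamily {ι : Type} [Fintype ι] (A : ι → Matrix (Fin 2) (Fin 2) ℂ) :
    Matrix (ι → Fin 2) (ι → Fin 2) ℂ :=
  Matrix.of fun v w => ∏ j, A j (v j) (w j)

theorem kronFamily_mul {ι : Type} [Fintype ι] [DecidableEq ι]
    (A B : ι → Matrix (Fin 2) (Fin 2) ℂ) :
    kronFamily A * kronFamily B = kronFamily fun j => A j * B j := by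
  ext v w
  simp only [kronFamily, Matrix.mul_apply, Matrix.of_apply, Fintype.prod_sum,
    Finset.prod_mul_distrib]

theorem kronFamily_transpose {ι : Type} [Fintype ι] (A : ι → Matrix (Fin 2) (Fin 2) ℂ) :
    (kronFamily A)ᵀ = kronFamily fun j => (A j)ᵀ := rfl

theorem kronFamily_one {ι : Type} [Fintype ι] [DecidableEq ι] :
    kronFamily (fun _ : ι => (1 : Matrix (Fin 2) (Fin 2) ℂ)) = 1 := by
  ext v w
  by_cases h : v = w
  · subst h
    simp [kronFamily]
  · obtain ⟨j, hj⟩ := Function.ne_iff.mp h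
    rw [Matrix.one_apply_ne h]
    exact Finset.prod_eq_zero (Finset.mem_univ j) (Matrix.one_apply_ne hj)

theorem act2_eq_mulVec {n : ℕ} (A : Fin n → Matrix (Fin 2) (Fin 2) ℂ)
    (Φ : (Fin n → Fin 2) → ℂ) : act2 A Φ = kronFamily A *ᵥ Φ := rfl

theorem mul_J_mul_transpose (A : Matrix (Fin 2) (Fin 2) ℂ) : A * _root_.J * Aᵀ = A.det • _root_.J := by
  ext a b
  fin_cases a <;> fin_cases b <;>
    simp [_root_.J, Matrix.mul_apply, Fin.sum_univ_two, Matrix.det_fin_two] <;> ring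

/-- `J^{⊗ι}` is invariant under congruence by Kronecker products of matrices in `SL₂`. -/
theorem kronFamily_transpose_mul_kronPowJ_mul {ι : Type} [Fintype ι] [DecidableEq ι]
    {A : ι → Matrix (Fin 2) (Fin 2) ℂ} (hA : ∀ j, (A j).det = 1) :
    (kronFamily A)ᵀ * kronPowJ ι * kronFamily A = kronPowJ ι := by
  have hJ : kronPowJ ι = kronFamily fun _ => _root_.J := rfl
  rw [hJ, kronFamily_transpose, kronFamily_mul, kronFamily_mul]
  congr 1
  funext j
  simpa [hA j] using mul_J_mul_transpose (A j)ᵀ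

theorem kronPowJ_transpose {ι : Type} [Fintype ι] (hι : Even (Fintype.card ι)) :
    (kronPowJ ι)ᵀ = kronPowJ ι := by
  have hJ : ∀ a b, _root_.J b a = -_root_.J a b := by
    intro a b
    fin_cases a <;> fin_cases b <;> simp [_root_.J]
  ext v w
  simp only [kronPowJ, Matrix.transpose_apply, Matrix.of_apply]
  simp_rw [fun j => hJ (v j) (w j)]
  rw [Finset.prod_neg, Finset.card_univ, hι.neg_one_pow, one_mul]

theorem qflat_act2 {n : ℕ} (A : Fin n → Matrix (Fin 2) (Fin 2) ℂ)
    (Φ : (Fin n → Fin 2) → ℂ) (i : Fin n) :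
    qflat (act2 A Φ) i =
      A i * qflat Φ i * (kronFamily fun j : {j : Fin n // j ≠ i} => A j)ᵀ := by
  ext a w
  simp only [qflat, act2, kronFamily, Matrix.mul_apply, Matrix.of_apply,
    Matrix.transpose_apply]
  rw [← (Equiv.funSplitAt i (Fin 2)).symm.sum_comp, Fintype.sum_prod_type, Finset.sum_comm]
  refine Finset.sum_congr rfl fun u _ => ?_
  rw [Finset.sum_mul]
  refine Finset.sum_congr rfl fun b _ => ?_
  rw [Fintype.prod_eq_mul_prod_subtype_ne _ i]
  have h : ∀ j : {j : Fin n // j ≠ i},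
      A j (if h : (j : Fin n) = i then a else w ⟨j, h⟩)
        ((Equiv.funSplitAt i (Fin 2)).symm (b, u) j) = A j (w j) (u j) := by
    intro j
    simp [j.2]
  simp only [h]
  simp [Equiv.funSplitAt, Equiv.piSplitAt]
  ring

/-- The matrix `D i` of a tensor transforms by congruence under `SL₂ × ⋯ × SL₂`. -/
theorem qflat_act2_mul_kronPowJ_mul_transpose {n : ℕ} {A : Fin n → Matrix (Fin 2) (Fin 2) ℂ}
    (hA : ∀ j, (A j).det = 1) (Φ : (Fin n → Fin 2) → ℂ) (i : Fin n) :
    qflat (act2 A Φ) i * kronPowJ {j : Fin n // j ≠ i} * (qflat (act2 A Φ) i)ᵀ =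
      A i * (qflat Φ i * kronPowJ {j : Fin n // j ≠ i} * (qflat Φ i)ᵀ) * (A i)ᵀ := by
  rw [qflat_act2]
  conv_rhs => rw [← kronFamily_transpose_mul_kronPowJ_mul
    (A := fun j : {j : Fin n // j ≠ i} => A j) fun j => hA j]
  simp only [Matrix.transpose_mul, Matrix.transpose_transpose, Matrix.mul_assoc]

theorem exists_sq_eq_and_clexLe_neg (d : ℂ) : ∃ z : ℂ, z ^ 2 = d ∧ clexLe (-z) z := by
  obtain ⟨z, hz⟩ := IsAlgClosed.exists_pow_nat_eq d two_pos
  by_cases h : clexLe (-z) z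
  · exact ⟨z, hz, h⟩
  · refine ⟨-z, by rw [neg_sq, hz], ?_⟩
    simp only [clexLe, Complex.neg_re, Complex.neg_im, neg_neg, not_or, not_and, not_lt,
      not_le] at h ⊢
    rcases h.1.lt_or_eq with h₁ | h₁
    · exact Or.inl h₁
    · exact Or.inr ⟨h₁, (h.2 h₁.symm).le⟩

theorem exists_det_eq_one_congr_zero_zero_ne_zero {S : Matrix (Fin 2) (Fin 2) ℂ}
    (hS : Sᵀ = S) (h0 : S ≠ 0) :
    ∃ C : Matrix (Fin 2) (Fin 2) ℂ, C.det = 1 ∧ (C * S * Cᵀ) 0 0 ≠ 0 := by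
  have hs : S 1 0 = S 0 1 := congrFun (congrFun hS 0) 1
  by_cases ha : S 0 0 = 0
  · by_cases hc : S 1 1 = 0
    · refine ⟨!![1, 1; 0, 1], by simp [Matrix.det_fin_two], fun h => h0 ?_⟩
      have hb : S 0 1 = 0 := by
        simpa [Matrix.mul_apply, Matrix.vecMul, dotProduct, Fin.sum_univ_two, ha, hc, hs] using h
      ext a b
      fin_cases a <;> fin_cases b <;> simp [ha, hb, hc, hs]
    · refine ⟨!![0, 1; -1, 0], by simp [Matrix.det_fin_two], ?_⟩
      simpa [Matrix.mul_apply, Matrix.vecMul, dotProduct, Fin.sum_univ_two] using hc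
  · exact ⟨1, by simp, by simpa using ha⟩

/-- Normal form of a complex symmetric `2 × 2` matrix with nonzero corner, under congruence
by `SL₂`. -/
theorem exists_det_eq_one_congr_eq_diagonal {S : Matrix (Fin 2) (Fin 2) ℂ}
    (hS : Sᵀ = S) (ha : S 0 0 ≠ 0) {x : ℂ} (hx : x ≠ 0) :
    ∃ C : Matrix (Fin 2) (Fin 2) ℂ, C.det = 1 ∧
      C * S * Cᵀ = Matrix.diagonal ![x, S.det / x] := by
  have hs : S 1 0 = S 0 1 := congrFun (congrFun hS 0) 1
  obtain ⟨s, hs2⟩ := IsAlgClosed.exists_pow_nat_eq (x / S 0 0) two_pos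
  have hs0 : s ≠ 0 := by
    rintro rfl
    exact div_ne_zero hx ha (by simpa using hs2.symm)
  have hx' : x = s ^ 2 * S 0 0 := by rw [hs2, div_mul_cancel₀ _ ha]
  refine ⟨!![s, 0; -(S 0 1 / S 0 0) / s, 1 / s], by simp [Matrix.det_fin_two, hs0], ?_⟩
  subst hx'
  ext a b
  fin_cases a <;> fin_cases b <;>
    simp [Matrix.mul_apply, Matrix.vecMul, dotProduct, Fin.sum_univ_two, Matrix.det_fin_two,
      hs, hs0] <;> field_simp <;> ring

theorem exists_det_eq_one_congr_normal_form {S : Matrix (Fin 2) (Fin 2) ℂ} (hS : Sᵀ = S) :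
    ∃ C : Matrix (Fin 2) (Fin 2) ℂ, C.det = 1 ∧ ∃ z : ℂ, clexLe (-z) z ∧
      (C * S * Cᵀ = z • (1 : Matrix (Fin 2) (Fin 2) ℂ) ∨
        C * S * Cᵀ = Matrix.diagonal ![z, 0] ∨ C * S * Cᵀ = 0) := by
  by_cases h0 : S = 0
  · exact ⟨1, by simp, 0, Or.inr (by simp), Or.inr (Or.inr (by simp [h0]))⟩
  obtain ⟨B, hB, hB0⟩ := exists_det_eq_one_congr_zero_zero_ne_zero hS h0
  have hT : (B * S * Bᵀ)ᵀ = B * S * Bᵀ := by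
    simp [Matrix.transpose_mul, hS, Matrix.mul_assoc]
  have hcongr : ∀ C, C * B * S * (C * B)ᵀ = C * (B * S * Bᵀ) * Cᵀ := by
    intro C
    simp [Matrix.transpose_mul, Matrix.mul_assoc]
  have hdet : (B * S * Bᵀ).det = S.det := by simp [hB]
  by_cases hd : S.det = 0
  · obtain ⟨C, hC, h⟩ := exists_det_eq_one_congr_eq_diagonal hT hB0 one_ne_zero
    refine ⟨C * B, by simp [hB, hC], 1, Or.inl (by norm_num), Or.inr (Or.inl ?_)⟩
    rw [hcongr, h, hdet, hd, zero_div]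
  · obtain ⟨z, hz, hle⟩ := exists_sq_eq_and_clexLe_neg S.det
    have hz0 : z ≠ 0 := by
      rintro rfl
      exact hd (by simp [← hz])
    obtain ⟨C, hC, h⟩ := exists_det_eq_one_congr_eq_diagonal hT hB0 hz0
    refine ⟨C * B, by simp [hB, hC], z, hle, Or.inl ?_⟩
    rw [hcongr, h, hdet, ← hz, pow_two, mul_div_cancel_right₀ _ hz0]
    ext a b
    fin_cases a <;> fin_cases b <;> simp

/-- **Odd SLOCC core tensors.** For odd `n`, every `n`-qubit tensor `Φ` can be
written as `Φ = (A 1 ⊗ ⋯ ⊗ A n) Ψ` with all `A i ∈ SL_2(ℂ)` such that each matrix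
`D i = Ψ₍ᵢ₎ J^{⊗(n-1)} Ψ₍ᵢ₎ᵀ` equals `z • I₂`, `diag(z, 0)`, or `0` for some `z`
with `z ≥ -z` in the lexicographic order on `ℂ`. -/
theorem odd_slocc_core_tensor {n : ℕ} (hn : Odd n) (Φ : (Fin n → Fin 2) → ℂ) :
    ∃ (A : Fin n → Matrix (Fin 2) (Fin 2) ℂ) (Ψ : (Fin n → Fin 2) → ℂ),
      (∀ i, (A i).det = 1) ∧
      Φ = act2 A Ψ ∧
      ∀ i : Fin n, ∃ z : ℂ, clexLe (-z) z ∧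
        (qflat Ψ i * kronPowJ {j : Fin n // j ≠ i} * (qflat Ψ i)ᵀ
            = z • (1 : Matrix (Fin 2) (Fin 2) ℂ) ∨
         qflat Ψ i * kronPowJ {j : Fin n // j ≠ i} * (qflat Ψ i)ᵀ
            = Matrix.diagonal ![z, 0] ∨
         qflat Ψ i * kronPowJ {j : Fin n // j ≠ i} * (qflat Ψ i)ᵀ = 0) := by
  have hsymm : ∀ i : Fin n, (qflat Φ i * kronPowJ {j : Fin n // j ≠ i} * (qflat Φ i)ᵀ)ᵀ =
      qflat Φ i * kronPowJ {j : Fin n // j ≠ i} * (qflat Φ i)ᵀ := by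
    intro i
    have hcard : Even (Fintype.card {j : Fin n // j ≠ i}) := by
      simpa [Fintype.card_subtype_compl] using Nat.Odd.sub_odd hn odd_one
    simp [Matrix.transpose_mul, kronPowJ_transpose hcard, Matrix.mul_assoc]
  choose C hC hD using fun i => exists_det_eq_one_congr_normal_form (hsymm i)
  refine ⟨fun i => (C i)⁻¹, act2 C Φ, fun i => by simp [Matrix.det_nonsing_inv, hC i], ?_,
    fun i => ?_⟩
  · have hinv : ∀ i, (C i)⁻¹ * C i = 1 := fun i =>
      Matrix.nonsing_inv_mul _ (by simp [hC i])
    simp only [act2_eq_mulVec, Matrix.mulVec_mulVec, kronFamily_mul, hinv, kronFamily_one,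
      Matrix.one_mulVec]
  · rw [qflat_act2_mul_kronPowJ_mul_transpose hC]
    exact hD i

end
end

section
/- Let k ≥ 2 and n = 2k + 1. Let E ⊆ {0,1}^n be the set of vectors with an even number of nonzero entries, and define the tensor Φ ∈ (ℂ²)^{⊗n} by Φ(0,…,0) = 1 − 2^{2k−1}, Φ(v) = 1 for every v ∈ E with v ≠ 0, and Φ(v) = 0 for v ∉ E. Then for every 1 ≤ i ≤ n: (a) Φ₍ᵢ₎ · J^{⊗2k} · Φ₍ᵢ₎ᵀ = −2^{2k−1} · I_2, and (b) Φ₍ᵢ₎ · Φ₍ᵢ₎ᵀ is the diagonal matrix with diagonal entries (2^{2k−1} − 1)² + (2^{2k−1} − 1) and 2^{2k−1}, which are distinct. -/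
open Matrix

noncomputable section

/-- The Hamming weight of a bit vector. -/
def hammingWt {n : ℕ} (v : Fin n → Fin 2) : ℕ :=
  (Finset.univ.filter (fun j => v j = 1)).card

/-- The witness tensor of the genericity lemma: `Φ(0,…,0) = 1 − 2^{2k−1}`,
`Φ(v) = 1` for `v ≠ 0` of even Hamming weight, and `Φ(v) = 0` otherwise. -/
def witnessTensor (k : ℕ) : (Fin (2 * k + 1) → Fin 2) → ℂ :=
  fun v =>
    if v = (fun _ => 0) then 1 - 2 ^ (2 * k - 1)
    else if Even (hammingWt v) then 1 else 0

/-- The sign `(-1)^{|v|}` of a bit vector. -/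
def bitSign {ι : Type} [Fintype ι] (v : ι → Fin 2) : ℂ := ∏ j, (-1) ^ (v j : ℕ)

/-- The indicator of the zero bit vector. -/
def bitDelta {ι : Type} [Fintype ι] (v : ι → Fin 2) : ℂ := if v = (fun _ => 0) then 1 else 0

section bitSign

variable {ι : Type} [Fintype ι]

theorem bitSign_zero : bitSign (fun _ : ι => (0 : Fin 2)) = 1 := by
  simp [bitSign]

theorem bitSign_mul_self (v : ι → Fin 2) : bitSign v * bitSign v = 1 := by
  simp only [bitSign, ← Finset.prod_mul_distrib, ← mul_pow]
  simp

theorem bitSign_rev (hι : Even (Fintype.card ι)) (v : ι → Fin 2) :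
    bitSign (fun j => (v j).rev) = bitSign v := by
  have h : ∀ a : Fin 2, (-1 : ℂ) ^ (a.rev : ℕ) = -1 * (-1) ^ (a : ℕ) := by
    intro a
    fin_cases a <;> simp [Fin.rev]
  simp only [bitSign, h, Finset.prod_mul_distrib]
  simp [Finset.card_univ, hι.neg_one_pow]

theorem sum_bitSign [DecidableEq ι] [Nonempty ι] : ∑ v : ι → Fin 2, bitSign v = 0 := by
  unfold bitSign
  rw [← Fintype.prod_sum (fun (_ : ι) (a : Fin 2) => (-1 : ℂ) ^ (a : ℕ))]
  simp

theorem kronPowJ_apply (v w : ι → Fin 2) :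
    kronPowJ ι v w = if w = (fun j => (v j).rev) then bitSign v else 0 := by
  have h : ∀ a b : Fin 2, _root_.J a b = if b = a.rev then (-1) ^ (a : ℕ) else 0 := by
    intro a b
    fin_cases a <;> fin_cases b <;> simp [_root_.J, Fin.rev]
  simp only [kronPowJ, Matrix.of_apply, h, Finset.prod_ite_zero, bitSign, funext_iff,
    Finset.mem_univ, true_implies]

theorem mul_kronPowJ_mul_transpose_apply [DecidableEq ι]
    (M : Matrix (Fin 2) (ι → Fin 2) ℂ) (a b : Fin 2) :
    (M * kronPowJ ι * Mᵀ) a b = ∑ v, M a v * bitSign v * M b (fun j => (v j).rev) := by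
  rw [Matrix.mul_assoc, Matrix.mul_apply]
  refine Finset.sum_congr rfl fun v _ => ?_
  simp [Matrix.mul_apply, kronPowJ_apply, mul_assoc]

theorem bitDelta_rev (v : ι → Fin 2) :
    bitDelta (fun j => (v j).rev) = if v = (fun _ => 1) then 1 else 0 := by
  have h : ∀ a : Fin 2, a.rev = 0 ↔ a = 1 := by decide
  simp only [bitDelta, funext_iff, h]

theorem bitDelta_mul_self (v : ι → Fin 2) : bitDelta v * bitDelta v = bitDelta v := by
  simp [bitDelta]

theorem bitDelta_mul_bitSign (v : ι → Fin 2) : bitDelta v * bitSign v = bitDelta v := by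
  by_cases h : v = fun _ => 0 <;> simp [bitDelta, h, bitSign_zero]

theorem bitDelta_mul_bitDelta_rev [Nonempty ι] (v : ι → Fin 2) :
    bitDelta v * bitDelta (fun j => (v j).rev) = 0 := by
  have h : (fun _ : ι => (0 : Fin 2)) ≠ fun _ => 1 := by simp [funext_iff]
  rw [bitDelta_rev, bitDelta]
  aesop

theorem sum_eq_of_bitSign_bitDelta_combination [DecidableEq ι] [Nonempty ι]
    {f : (ι → Fin 2) → ℂ} (x y z t : ℂ)
    (hf : ∀ v, f v =
      x + y * bitSign v + z * bitDelta v + t * bitDelta (fun j => (v j).rev)) :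
    ∑ v, f v = 2 ^ Fintype.card ι * x + z + t := by
  simp only [hf, bitDelta_rev]
  simp [Finset.sum_add_distrib, ← Finset.mul_sum, sum_bitSign, bitDelta]

end bitSign

theorem bitSign_eq_neg_one_pow_hammingWt {n : ℕ} (v : Fin n → Fin 2) :
    bitSign v = (-1) ^ hammingWt v := by
  have h : ∀ a : Fin 2, (-1 : ℂ) ^ (a : ℕ) = if a = 1 then -1 else 1 := by
    intro a
    fin_cases a <;> simp
  simp [bitSign, h, hammingWt, Finset.prod_ite]

theorem witnessTensor_eq (k : ℕ) (v : Fin (2 * k + 1) → Fin 2) :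
    witnessTensor k v =
      (1 + bitSign v) / 2 - if v = (fun _ => 0) then (2 : ℂ) ^ (2 * k - 1) else 0 := by
  by_cases h : v = fun _ => 0
  · simp [witnessTensor, h, bitSign_zero]
  · rcases Nat.even_or_odd (hammingWt v) with he | ho
    · simp [witnessTensor, h, he, bitSign_eq_neg_one_pow_hammingWt]
    · simp [witnessTensor, h, ho.neg_one_pow, Nat.not_even_iff_odd.mpr ho,
        bitSign_eq_neg_one_pow_hammingWt]

theorem bitSign_insert {n : ℕ} (i : Fin n) (a : Fin 2) (w : {j : Fin n // j ≠ i} → Fin 2) :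
    bitSign (fun j => if h : j = i then a else w ⟨j, h⟩) = (-1) ^ (a : ℕ) * bitSign w := by
  unfold bitSign
  rw [← Fintype.prod_subtype_mul_prod_subtype (fun j => j = i)]
  congr 1
  · have h : ((default : {j : Fin n // j = i}) : Fin n) = i := (default : {j // j = i}).2
    simp [h]
  · exact Finset.prod_congr rfl fun j _ => by simp [j.2]

theorem qflat_witnessTensor_zero (k : ℕ) (i : Fin (2 * k + 1))
    (w : {j : Fin (2 * k + 1) // j ≠ i} → Fin 2) :
    qflat (witnessTensor k) i 0 w =
      (1 + bitSign w) / 2 - 2 ^ (2 * k - 1) * bitDelta w := by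
  have h : (fun j => if h : j = i then (0 : Fin 2) else w ⟨j, h⟩) = (fun _ => 0) ↔
      w = fun _ => 0 := by
    constructor
    · intro h
      funext j
      simpa [j.2] using congrFun h j
    · rintro rfl
      simp
  simp [qflat, witnessTensor_eq, bitSign_insert, h, bitDelta]

theorem qflat_witnessTensor_one (k : ℕ) (i : Fin (2 * k + 1))
    (w : {j : Fin (2 * k + 1) // j ≠ i} → Fin 2) :
    qflat (witnessTensor k) i 1 w = (1 - bitSign w) / 2 := by
  have h : (fun j => if h : j = i then (1 : Fin 2) else w ⟨j, h⟩) ≠ fun _ => 0 := by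
    intro h
    simpa using congrFun h i
  simp [qflat, witnessTensor_eq, bitSign_insert, h, sub_eq_add_neg]

/-- **Genericity witness.** For `k ≥ 2` and `n = 2k + 1`, the witness tensor `Φ`
satisfies, for every mode `i`:
(a) `Φ₍ᵢ₎ J^{⊗2k} Φ₍ᵢ₎ᵀ = −2^{2k−1} • I₂`, and
(b) `Φ₍ᵢ₎ Φ₍ᵢ₎ᵀ = diag((2^{2k−1} − 1)² + (2^{2k−1} − 1), 2^{2k−1})`, whose two
diagonal entries are distinct. -/
theorem witness_tensor_is_generic {k : ℕ} (hk : 2 ≤ k) (i : Fin (2 * k + 1)) :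
    (qflat (witnessTensor k) i * kronPowJ {j : Fin (2 * k + 1) // j ≠ i} *
        (qflat (witnessTensor k) i)ᵀ
      = (-(2 : ℂ) ^ (2 * k - 1)) • (1 : Matrix (Fin 2) (Fin 2) ℂ)) ∧
    (qflat (witnessTensor k) i * (qflat (witnessTensor k) i)ᵀ
      = Matrix.diagonal
          ![((2 : ℂ) ^ (2 * k - 1) - 1) ^ 2 + ((2 : ℂ) ^ (2 * k - 1) - 1),
            (2 : ℂ) ^ (2 * k - 1)]) ∧
    ((2 : ℂ) ^ (2 * k - 1) - 1) ^ 2 + ((2 : ℂ) ^ (2 * k - 1) - 1)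
      ≠ (2 : ℂ) ^ (2 * k - 1) := by
  have hcard : Fintype.card {j : Fin (2 * k + 1) // j ≠ i} = 2 * k := by
    simp [Fintype.card_subtype_compl]
  have heven : Even (Fintype.card {j : Fin (2 * k + 1) // j ≠ i}) := by simp [hcard]
  have : Nonempty {j : Fin (2 * k + 1) // j ≠ i} := by
    rw [← Fintype.card_pos_iff]
    omega
  have hpow : (2 : ℂ) ^ (2 * k) = 2 * 2 ^ (2 * k - 1) := by
    rw [← pow_succ']
    congr 1
    omega
  have hc : (8 : ℝ) ≤ 2 ^ (2 * k - 1) := by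
    calc (8 : ℝ) = 2 ^ 3 := by norm_num
      _ ≤ 2 ^ (2 * k - 1) := pow_le_pow_right₀ (by norm_num) (by omega)
  have hsum := @sum_eq_of_bitSign_bitDelta_combination {j : Fin (2 * k + 1) // j ≠ i} _ _ _
  rw [hcard, hpow] at hsum
  have h0 := qflat_witnessTensor_zero k i
  have h1 := qflat_witnessTensor_one k i
  set c : ℂ := 2 ^ (2 * k - 1) with hcdef
  have hrev := bitSign_rev heven
  have hss := bitSign_mul_self (ι := {j : Fin (2 * k + 1) // j ≠ i})
  have hds := bitDelta_mul_bitSign (ι := {j : Fin (2 * k + 1) // j ≠ i})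
  have hdd := bitDelta_mul_self (ι := {j : Fin (2 * k + 1) // j ≠ i})
  have hdr := bitDelta_mul_bitDelta_rev (ι := {j : Fin (2 * k + 1) // j ≠ i})
  have hrs : ∀ v : {j : Fin (2 * k + 1) // j ≠ i} → Fin 2,
      bitDelta (fun j => (v j).rev) * bitSign v = bitDelta (fun j => (v j).rev) := by
    intro v
    rw [← hrev v]
    exact hds _
  refine ⟨?_, ?_, ?_⟩
  · ext a b
    rw [mul_kronPowJ_mul_transpose_apply]
    fin_cases a <;> fin_cases b <;> simp [h0, h1, hrev]
    · rw [hsum (1 / 2) (1 / 2) (-c) (-c) (fun v => by grind)]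
      ring
    · rw [hsum 0 0 0 0 (fun v => by grind)]
      ring
    · rw [hsum 0 0 0 0 (fun v => by grind)]
      ring
    · rw [hsum (-1 / 2) (1 / 2) 0 0 (fun v => by grind)]
      ring
  · ext a b
    rw [Matrix.mul_apply]
    fin_cases a <;> fin_cases b <;> simp [h0, h1]
    · rw [hsum (1 / 2) (1 / 2) (c ^ 2 - 2 * c) 0 (fun v => by grind)]
      ring
    · rw [hsum 0 0 0 0 (fun v => by grind)]
      ring
    · rw [hsum 0 0 0 0 (fun v => by grind)]
      ring
    · rw [hsum (1 / 2) (-1 / 2) 0 0 (fun v => by grind)]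
      ring
  · intro h
    have hreal : ((2 : ℝ) ^ (2 * k - 1) - 1) ^ 2 + ((2 : ℝ) ^ (2 * k - 1) - 1) =
        2 ^ (2 * k - 1) := by
      apply Complex.ofReal_injective
      push_cast
      exact h
    nlinarith

end
end
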